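/- If the basic sequence $Q = (q_n)$ satisfies $q_n \to \infty$, then the set $\mathscr{DN}(Q) \setminus \bigcup_{j=1}^\infty \mathscr{RN}_j(Q)$ has Hausdorff dimension $1$, where $\mathscr{RN}_j(Q)$ is the set of numbers that are $Q$-ratio normal of order $j$. -/

import Mathlib

open scoped Classical
open Filter MeasureTheory

noncomputable section

/-- Product of the first `n` bases of a basic sequence. -/
def cantorProd (q : ℕ → ℕ) (n : ℕ) : ℝ := ∏ i ∈ Finset.range n, (q i : ℝ)

/-- `E` is the sequence of digits of the `Q`-Cantor series expansion of `x`
(the digit `E n` is the digit `E_{n+1}` of the paper, in base `q n = q_{n+1}`). -/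
def IsCantorExp (q : ℕ → ℕ) (x : ℝ) (E : ℕ → ℕ) : Prop :=
  (∀ n, E n < q n) ∧ (∀ m, ∃ n, m ≤ n ∧ E n ≠ q n - 1) ∧
  x = (⌊x⌋ : ℝ) + ∑' n, (E n : ℝ) / cantorProd q (n + 1)

/-- Number of occurrences of the block `B` of length `k` among the first `n` digits. -/
def blockCount (E : ℕ → ℕ) (k : ℕ) (B : Fin k → ℕ) (n : ℕ) : ℕ :=
  ((Finset.range (n + 1 - k)).filter (fun j => ∀ i : Fin k, E (j + i) = B i)).card

/-- `Q_n^{(k)}`. -/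
def Qnk (q : ℕ → ℕ) (k n : ℕ) : ℝ :=
  ∑ j ∈ Finset.range n, 1 / ∏ i ∈ Finset.range k, (q (j + i) : ℝ)

/-- `x` is `Q`-normal of order `k`. -/
def QNormalOrder (q : ℕ → ℕ) (k : ℕ) (x : ℝ) : Prop :=
  ∃ E, IsCantorExp q x E ∧ ∀ B : Fin k → ℕ,
    Tendsto (fun n => (blockCount E k B n : ℝ) / Qnk q k n) atTop (nhds 1)

/-- `x` is `Q`-ratio normal of order `k`. -/
def QRatioNormalOrder (q : ℕ → ℕ) (k : ℕ) (x : ℝ) : Prop :=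
  ∃ E, IsCantorExp q x E ∧ ∀ B₁ B₂ : Fin k → ℕ,
    Tendsto (fun n => (blockCount E k B₁ n : ℝ) / (blockCount E k B₂ n : ℝ))
      atTop (nhds 1)

/-- A sequence of reals is uniformly distributed mod 1. -/
def UDMod1 (u : ℕ → ℝ) : Prop :=
  ∀ a b : ℝ, 0 ≤ a → a ≤ b → b ≤ 1 →
    Tendsto
      (fun N => (((Finset.range N).filter
          (fun n => Int.fract (u n) ∈ Set.Ico a b)).card : ℝ) / N)
      atTop (nhds (b - a))

/-- `x` is `Q`-distribution normal. -/
def QDistNormal (q : ℕ → ℕ) (x : ℝ) : Prop :=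
  UDMod1 (fun n => cantorProd q n * x)


lemma cP_zero (q : ℕ → ℕ) : cantorProd q 0 = 1 := by simp [cantorProd]

lemma cP_succ (q : ℕ → ℕ) (n : ℕ) : cantorProd q (n+1) = cantorProd q n * q n := by
  simp [cantorProd, Finset.prod_range_succ]

lemma cP_pos {q : ℕ → ℕ} (hq : ∀ n, 2 ≤ q n) (n : ℕ) : 0 < cantorProd q n := by
  unfold cantorProd
  apply Finset.prod_pos
  intro i _
  have := hq i
  exact_mod_cast (by omega : 0 < q i)

lemma cP_two_pow {q : ℕ → ℕ} (hq : ∀ n, 2 ≤ q n) (n : ℕ) : (2:ℝ)^n ≤ cantorProd q n := by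
  induction n with
  | zero => simp [cP_zero]
  | succ n ih =>
    rw [cP_succ, pow_succ]
    have : (2:ℝ) ≤ q n := by exact_mod_cast hq n
    have h0 : (0:ℝ) < 2^n := by positivity
    nlinarith

/-- integer formed by the first digits -/
def pre (q E : ℕ → ℕ) : ℕ → ℕ
  | 0 => 0
  | n+1 => q n * pre q E n + E n

def tailT (q E : ℕ → ℕ) (n : ℕ) : ℝ :=
  cantorProd q n * ∑' k, (E (n+k) : ℝ) / cantorProd q (n+k+1)

lemma partial_tail {q E : ℕ → ℕ} (hq : ∀ n, 2 ≤ q n) (hE : ∀ n, E n < q n) (n m : ℕ) :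
    ∑ k ∈ Finset.range m, (E (n+k) : ℝ) / cantorProd q (n+k+1) ≤
      1 / cantorProd q n - 1 / cantorProd q (n+m) := by
  induction m with
  | zero => simp
  | succ m ih =>
    rw [Finset.sum_range_succ]
    have h1 : (E (n+m) : ℝ) / cantorProd q (n+m+1) ≤
        1 / cantorProd q (n+m) - 1 / cantorProd q (n+m+1) := by
      rw [cP_succ]
      have hp := cP_pos hq (n+m)
      have hq' : (0:ℝ) < q (n+m) := by have := hq (n+m); exact_mod_cast (by omega : 0 < q (n+m))
      have hE' : (E (n+m) : ℝ) + 1 ≤ q (n+m) := by exact_mod_cast hE (n+m)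
      have : 1 / cantorProd q (n+m) - 1 / (cantorProd q (n+m) * q (n+m)) =
        (q (n+m) - 1) / (cantorProd q (n+m) * q (n+m)) := by field_simp
      rw [this]
      gcongr
      linarith
    rw [← add_assoc]
    linarith

lemma summable_tail {q E : ℕ → ℕ} (hq : ∀ n, 2 ≤ q n) (hE : ∀ n, E n < q n) (n : ℕ) :
    Summable (fun k => (E (n+k) : ℝ) / cantorProd q (n+k+1)) := by
  apply summable_of_sum_range_le (c := 1 / cantorProd q n)
  · intro k; have := cP_pos hq (n+k+1); positivity
  · intro m
    have := partial_tail hq hE n m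
    have h2 := cP_pos hq (n+m)
    have : 0 < 1 / cantorProd q (n+m) := by positivity
    linarith

lemma tailT_nonneg {q E : ℕ → ℕ} (hq : ∀ n, 2 ≤ q n) (n : ℕ) : 0 ≤ tailT q E n := by
  unfold tailT
  apply mul_nonneg (cP_pos hq n).le
  apply tsum_nonneg
  intro k; have := cP_pos hq (n+k+1); positivity

lemma tailT_le_one {q E : ℕ → ℕ} (hq : ∀ n, 2 ≤ q n) (hE : ∀ n, E n < q n) (n : ℕ) :
    tailT q E n ≤ 1 := by
  unfold tailT
  have h : ∑' k, (E (n+k) : ℝ) / cantorProd q (n+k+1) ≤ 1 / cantorProd q n := by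
    apply Real.tsum_le_of_sum_range_le
    · intro k; have := cP_pos hq (n+k+1); positivity
    · intro m
      have := partial_tail hq hE n m
      have h2 := cP_pos hq (n+m)
      have : 0 < 1 / cantorProd q (n+m) := by positivity
      linarith
  have hp := cP_pos hq n
  calc _ ≤ cantorProd q n * (1 / cantorProd q n) := by gcongr
    _ = 1 := by field_simp

lemma tailT_rec {q E : ℕ → ℕ} (hq : ∀ n, 2 ≤ q n) (hE : ∀ n, E n < q n) (n : ℕ) :
    q n * tailT q E n = E n + tailT q E (n+1) := by
  unfold tailT
  rw [(summable_tail hq hE n).tsum_eq_zero_add]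
  have e : (fun k => (E (n+(k+1)) : ℝ) / cantorProd q (n+(k+1)+1)) =
    fun k => (E (n+1+k) : ℝ) / cantorProd q (n+1+k+1) := by
    funext k
    rw [show n + (k+1) = n+1+k by ring]
  rw [e]
  simp only [add_zero]
  rw [cP_succ]
  have hp := cP_pos hq n
  have hq' : (0:ℝ) < q n := by have := hq n; exact_mod_cast (by omega : 0 < q n)
  field_simp

lemma tailT_pre {q E : ℕ → ℕ} (hq : ∀ n, 2 ≤ q n) (hE : ∀ n, E n < q n) (n : ℕ) :
    cantorProd q n * ∑' k, (E k : ℝ) / cantorProd q (k+1) = pre q E n + tailT q E n := by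
  induction n with
  | zero => simp [pre, tailT, cP_zero]
  | succ n ih =>
    rw [cP_succ, mul_right_comm, ih]
    have := tailT_rec hq hE n
    simp only [pre]
    push_cast
    linarith

lemma tailT_lt_one {q E : ℕ → ℕ} (hq : ∀ n, 2 ≤ q n) (hE : ∀ n, E n < q n)
    (hi : ∀ m, ∃ n, m ≤ n ∧ E n ≠ q n - 1) (n : ℕ) : tailT q E n < 1 := by
  by_contra hc
  have key : ∀ k, tailT q E (n+k) = 1 ∧ E (n+k) = q (n+k) - 1 := by
    have step : ∀ m, tailT q E m = 1 → tailT q E (m+1) = 1 ∧ E m = q m - 1 := by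
      intro m hm
      have h1 := tailT_rec hq hE m
      rw [hm] at h1
      have h2 := tailT_le_one hq hE (m+1)
      have h3 : (E m : ℝ) + 1 ≤ q m := by exact_mod_cast hE m
      have h4 : (E m : ℝ) + 1 = q m := by linarith
      have h5 : E m + 1 = q m := by exact_mod_cast h4
      exact ⟨by linarith, by omega⟩
    have h0 : ∀ k, tailT q E (n+k) = 1 := by
      intro k
      induction k with
      | zero => exact le_antisymm (tailT_le_one hq hE n) (not_lt.1 hc)
      | succ k ih => exact (step _ ih).1
    exact fun k => ⟨h0 k, (step _ (h0 k)).2⟩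
  obtain ⟨m, hm, hne⟩ := hi n
  obtain ⟨k, rfl⟩ := Nat.exists_eq_add_of_le hm
  exact hne (key k).2

lemma cP_cast (q : ℕ → ℕ) (n : ℕ) :
    cantorProd q n = ((∏ i ∈ Finset.range n, q i : ℕ) : ℝ) := by
  simp [cantorProd]

lemma fract_eq_tail {q E : ℕ → ℕ} (hq : ∀ n, 2 ≤ q n) (hE : ∀ n, E n < q n)
    (hi : ∀ m, ∃ n, m ≤ n ∧ E n ≠ q n - 1) (z : ℤ) (n : ℕ) :
    Int.fract (cantorProd q n * (z + ∑' k, (E k : ℝ) / cantorProd q (k+1))) = tailT q E n := by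
  rw [Int.fract_eq_iff]
  refine ⟨tailT_nonneg hq n, tailT_lt_one hq hE hi n,
    (∏ i ∈ Finset.range n, q i : ℕ) * z + pre q E n, ?_⟩
  rw [mul_add, tailT_pre hq hE, cP_cast]
  push_cast
  ring

/-- If `x` has an expansion without zeros, it is not ratio normal. -/
lemma not_RN {q E : ℕ → ℕ} (hq : ∀ n, 2 ≤ q n) (hE : ∀ n, E n < q n)
    (hi : ∀ m, ∃ n, m ≤ n ∧ E n ≠ q n - 1) (h1 : ∀ n, 1 ≤ E n) (j : ℕ) (hj : 1 ≤ j) :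
    ¬ QRatioNormalOrder q j (∑' k, (E k : ℝ) / cantorProd q (k+1)) := by
  rintro ⟨E', ⟨hE', hi', hx⟩, hR⟩
  have hne : ∀ n, E' n ≠ 0 := by
    intro n h0
    have e1 := fract_eq_tail hq hE hi 0 n
    have e2 := fract_eq_tail hq hE' hi' ⌊∑' k, (E k : ℝ) / cantorProd q (k+1)⌋ n
    rw [← hx] at e2
    simp only [Int.cast_zero, zero_add] at e1
    rw [e1] at e2
    have r1 := tailT_rec hq hE n
    have r2 := tailT_rec hq hE' n
    rw [h0] at r2
    have := tailT_lt_one hq hE' hi' (n+1)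
    have := tailT_nonneg (E := E) hq (n+1)
    have h1' : (1:ℝ) ≤ E n := by exact_mod_cast h1 n
    rw [e2] at r1
    push_cast at r2
    linarith
  have hz : ∀ n, blockCount E' j (fun _ => 0) n = 0 := by
    intro n
    unfold blockCount
    rw [Finset.card_eq_zero, Finset.filter_eq_empty_iff]
    intro i _ hc
    exact hne _ (hc ⟨0, hj⟩)
  have := hR (fun _ => 0) (fun _ => 0)
  simp only [hz] at this
  simp at this

lemma pre_inj {q E E' : ℕ → ℕ} (hE : ∀ n, E n < q n) (hE' : ∀ n, E' n < q n) (n : ℕ)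
    (h : pre q E n = pre q E' n) : ∀ i < n, E i = E' i := by
  induction n with
  | zero => intro i hi; omega
  | succ n ih =>
    simp only [pre] at h
    have a : (q n * pre q E n + E n) % q n = (q n * pre q E' n + E' n) % q n := by rw [h]
    rw [Nat.mul_add_mod, Nat.mul_add_mod, Nat.mod_eq_of_lt (hE n), Nat.mod_eq_of_lt (hE' n)] at a
    have b : pre q E n = pre q E' n := by
      have : q n * pre q E n = q n * pre q E' n := by omega
      exact Nat.eq_of_mul_eq_mul_left (by have := hE n; omega) this
    intro i hi
    rcases Nat.lt_succ_iff_lt_or_eq.1 hi with h' | rfl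
    · exact ih b i h'
    · exact a

/-- counting function -/
def cnt (v : ℕ → ℝ) (c : ℝ) (N : ℕ) : ℝ :=
  ∑ n ∈ Finset.range N, (if v n < c then (1:ℝ) else 0)

def clamp (c : ℝ) : ℝ := max 0 (min c 1)

lemma cnt_le_of_eventually {v t : ℕ → ℝ} {c d : ℝ} (h : ∀ᶠ n in atTop, v n < c → t n < d) :
    ∃ K : ℝ, ∀ N, cnt v c N ≤ cnt t d N + K := by
  obtain ⟨K, hK⟩ := eventually_atTop.1 h
  refine ⟨K, fun N => ?_⟩
  induction N with
  | zero => simp [cnt]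
  | succ N ih =>
    by_cases hN : K ≤ N
    · have : (if v N < c then (1:ℝ) else 0) ≤ if t N < d then (1:ℝ) else 0 := by
        have := hK N hN
        split_ifs <;> simp_all
      unfold cnt at *
      rw [Finset.sum_range_succ, Finset.sum_range_succ]
      linarith
    · have h1 : cnt v c (N+1) ≤ (N+1 : ℕ) := by
        unfold cnt
        calc _ ≤ ∑ n ∈ Finset.range (N+1), (1:ℝ) := by
              apply Finset.sum_le_sum; intro i _; split_ifs <;> norm_num
          _ = _ := by simp
      have h2 : 0 ≤ cnt t d (N+1) := by
        unfold cnt; apply Finset.sum_nonneg; intro i _; split_ifs <;> norm_num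
      have h3 : ((N+1 : ℕ):ℝ) ≤ K := by exact_mod_cast (by omega : N+1 ≤ K)
      linarith

lemma clamp_lip (a b : ℝ) (h : a ≤ b) : clamp b - clamp a ≤ b - a := by
  unfold clamp
  rcases max_cases 0 (min b 1) with ⟨h1, h2⟩ | ⟨h1, h2⟩ <;>
  rcases max_cases 0 (min a 1) with ⟨h3, h4⟩ | ⟨h3, h4⟩ <;>
  rcases min_cases a 1 with ⟨h5, h6⟩ | ⟨h5, h6⟩ <;>
  rcases min_cases b 1 with ⟨h7, h8⟩ | ⟨h7, h8⟩ <;> linarith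

lemma ud_transfer {v t : ℕ → ℝ}
    (hv : ∀ c : ℚ, Tendsto (fun N : ℕ => cnt v c N / N) atTop (nhds (clamp c)))
    (hd : Tendsto (fun n => t n - v n) atTop (nhds 0)) (c : ℝ) :
    Tendsto (fun N : ℕ => cnt t c N / N) atTop (nhds (clamp c)) := by
  rw [Metric.tendsto_atTop'] at hd
  have hdd : ∀ ε > 0, ∀ᶠ n in atTop, |t n - v n| < ε := by
    intro ε hε
    obtain ⟨N, hN⟩ := hd ε hε
    filter_upwards [eventually_gt_atTop N] with n hn
    simpa [Real.dist_eq] using hN n hn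
  have hK : ∀ K : ℝ, Tendsto (fun N : ℕ => K / N) atTop (nhds 0) :=
    fun K => tendsto_const_div_atTop_nhds_zero_nat K
  rw [tendsto_order]
  constructor
  · intro a ha
    obtain ⟨c1, hc1, hc1'⟩ := exists_rat_btwn (show c - (clamp c - a) < c by linarith)
    have hcl := clamp_lip c1 c hc1'.le
    obtain ⟨K, hk⟩ := cnt_le_of_eventually (v := v) (t := t) (c := c1) (d := c) (by
      filter_upwards [hdd (c - c1) (by linarith)] with n hn hv'
      rw [abs_lt] at hn; linarith)
    have := (hv c1).sub (hK K)
    have := this.eventually (lt_mem_nhds (show a < clamp c1 - 0 by linarith))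
    filter_upwards [this, eventually_gt_atTop 0] with N hN hN0
    refine lt_of_lt_of_le hN ?_
    rw [← sub_div]
    gcongr
    linarith [hk N]
  · intro a ha
    obtain ⟨c1, hc1, hc1'⟩ := exists_rat_btwn (show c < c + (a - clamp c) by linarith)
    have hcl := clamp_lip c c1 hc1.le
    obtain ⟨K, hk⟩ := cnt_le_of_eventually (v := t) (t := v) (c := c) (d := c1) (by
      filter_upwards [hdd (c1 - c) (by linarith)] with n hn hv'
      rw [abs_lt] at hn; linarith)
    have := (hv c1).add (hK K)
    have := this.eventually (gt_mem_nhds (show clamp c1 + 0 < a by linarith))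
    filter_upwards [this, eventually_gt_atTop 0] with N hN hN0
    refine lt_of_le_of_lt ?_ hN
    rw [← add_div]
    gcongr
    linarith [hk N]

lemma UD_of_cnt {u : ℕ → ℝ}
    (h : ∀ c : ℝ, Tendsto (fun N : ℕ => cnt (fun n => Int.fract (u n)) c N / N)
      atTop (nhds (clamp c))) : UDMod1 u := by
  intro a b ha hab hb
  have e : ∀ c, 0 ≤ c → c ≤ 1 → clamp c = c := by
    intro c h0 h1; simp [clamp, h0, h1]
  have := (h b).sub (h a)
  rw [e b (by linarith) hb, e a ha (by linarith)] at this
  refine this.congr fun N => ?_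
  rw [← sub_div]
  congr 1
  unfold cnt
  rw [← Finset.sum_sub_distrib, Finset.card_filter]
  push_cast
  apply Finset.sum_congr rfl
  intro n _
  simp only [Set.mem_Ico]
  by_cases h1 : Int.fract (u n) < a
  · have : Int.fract (u n) < b := by linarith
    simp [h1, this, not_le.2 h1]
  · by_cases h2 : Int.fract (u n) < b
    · simp [h1, h2, not_lt.1 h1]
    · simp [h1, h2]

/-- digit function avoiding zero -/
def dig (m : ℕ) (u : ℝ) : ℕ := 1 + ⌊Int.fract u * ((m:ℝ) - 1)⌋₊

lemma dig_pos (m : ℕ) (u : ℝ) : 1 ≤ dig m u := by unfold dig; omega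

lemma dig_bounds {m : ℕ} (hm : 2 ≤ m) (u : ℝ) :
    Int.fract u * ((m:ℝ) - 1) < dig m u ∧ (dig m u : ℝ) ≤ 1 + Int.fract u * ((m:ℝ) - 1) := by
  have hm' : (2:ℝ) ≤ m := by exact_mod_cast hm
  have h0 : 0 ≤ Int.fract u * ((m:ℝ) - 1) :=
    mul_nonneg (Int.fract_nonneg u) (by linarith)
  have h1 := Nat.floor_le h0
  have h2 := Nat.lt_floor_add_one (Int.fract u * ((m:ℝ) - 1))
  unfold dig
  push_cast
  constructor <;> linarith

lemma dig_lt {m : ℕ} (hm : 2 ≤ m) (u : ℝ) : dig m u < m := by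
  have hm' : (2:ℝ) ≤ m := by exact_mod_cast hm
  have h := (dig_bounds hm u).2
  have h1 := Int.fract_lt_one u
  have : (dig m u : ℝ) < m := by nlinarith
  exact_mod_cast this

lemma good_mem {q : ℕ → ℕ} (hq : ∀ n, 2 ≤ q n) (hlim : Tendsto q atTop atTop) (u : ℕ → ℝ)
    (hu : ∀ c : ℚ, Tendsto (fun N : ℕ => cnt (fun n => Int.fract (u n)) c N / N)
      atTop (nhds (clamp c))) :
    (∑' k, (dig (q k) (u k) : ℝ) / cantorProd q (k+1)) ∈ {x : ℝ | QDistNormal q x} \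
        ⋃ j ∈ Set.Ici 1, {x : ℝ | QRatioNormalOrder q j x} := by
  set E : ℕ → ℕ := fun k => dig (q k) (u k) with hEdef
  have hE : ∀ n, E n < q n := fun n => dig_lt (hq n) _
  have hi : ∀ m, ∃ n, m ≤ n ∧ E n ≠ q n - 1 := by
    intro m
    by_contra hc
    push Not at hc
    have hev : ∀ᶠ n in atTop, Int.fract (u n) < ((1/2 : ℚ) : ℝ) → (0:ℝ) < 0 := by
      filter_upwards [eventually_ge_atTop m, hlim.eventually_ge_atTop 4] with n hn h4 hf
      have h1 := hc n hn
      have h2 := (dig_bounds (hq n) (u n)).2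
      have h3 : dig (q n) (u n) + 1 = q n := by
        have : dig (q n) (u n) = q n - 1 := h1
        omega
      have h3' : (dig (q n) (u n) : ℝ) + 1 = q n := by exact_mod_cast h3
      have h4' : (4:ℝ) ≤ q n := by exact_mod_cast h4
      push_cast at hf
      nlinarith
    obtain ⟨K, hK⟩ := cnt_le_of_eventually (v := fun n => Int.fract (u n)) (t := fun _ => 0) hev
    have h0 : ∀ N, cnt (fun _ => 0) 0 N = 0 := by intro N; simp [cnt]
    have := le_of_tendsto_of_tendsto' (hu (1/2)) (tendsto_const_div_atTop_nhds_zero_nat K)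
      (fun N => by
        have := hK N
        rw [h0, zero_add] at this
        gcongr)
    norm_num [clamp] at this
  refine ⟨?_, ?_⟩
  · apply UD_of_cnt
    have he : (fun n => Int.fract (cantorProd q n * ∑' k, (E k : ℝ) / cantorProd q (k+1)))
        = tailT q E := by
      funext n
      have := fract_eq_tail hq hE hi 0 n
      simpa using this
    intro c
    simp only [hEdef] at he ⊢
    rw [he]
    refine ud_transfer hu ?_ c
    have hq0 : Tendsto (fun n => (2:ℝ) / (q n : ℝ)) atTop (nhds 0) :=
      (tendsto_const_div_atTop_nhds_zero_nat 2).comp hlim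
    apply squeeze_zero_norm _ hq0
    intro n
    have r := tailT_rec hq hE n
    have r0 := tailT_nonneg (E := E) hq (n+1)
    have r1 := tailT_le_one hq hE (n+1)
    have ⟨b1, b2⟩ := dig_bounds (hq n) (u n)
    have f0 := Int.fract_nonneg (u n)
    have f1 := Int.fract_lt_one (u n)
    have hqp : (2:ℝ) ≤ q n := by exact_mod_cast hq n
    simp only [hEdef] at r r0 r1
    rw [Real.norm_eq_abs, le_div_iff₀ (by linarith), ← abs_of_pos (show (0:ℝ) < q n by linarith),
      ← abs_mul, abs_le]
    constructor <;> nlinarith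
  · simp only [Set.mem_iUnion, Set.mem_Ici, Set.mem_ofPred_eq, not_exists]
    intro j hj
    exact not_RN hq hE hi (fun n => dig_pos _ _) j hj

def nu : Measure ℝ := volume.restrict (Set.Ico 0 1)

instance : IsProbabilityMeasure nu := ⟨by simp [nu]⟩

def Pm : Measure (ℕ → ℝ) := Measure.infinitePi (fun _ : ℕ => nu)

instance : IsProbabilityMeasure Pm := by unfold Pm; infer_instance

lemma nu_lt (c : ℝ) : nu.real {u | Int.fract u < c} = clamp c := by
  have hm : MeasurableSet {u : ℝ | Int.fract u < c} :=
    measurableSet_lt measurable_fract measurable_const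
  have : {u : ℝ | Int.fract u < c} ∩ Set.Ico 0 1 = Set.Ico 0 (min c 1) := by
    ext u
    constructor
    · rintro ⟨h1, h2⟩
      have h1 : Int.fract u < c := h1
      rw [Int.fract_eq_self.2 h2] at h1
      exact ⟨h2.1, lt_min h1 h2.2⟩
    · rintro ⟨h1, h2⟩
      have h3 : u ∈ Set.Ico (0:ℝ) 1 := ⟨h1, h2.trans_le (min_le_right _ _)⟩
      refine ⟨?_, h3⟩
      show Int.fract u < c
      rw [Int.fract_eq_self.2 h3]
      exact h2.trans_le (min_le_left _ _)
  rw [Measure.real, nu, Measure.restrict_apply hm, this, Real.volume_Ico, ENNReal.toReal_ofReal',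
    sub_zero, max_comm]
  rfl

lemma ae_ud : ∀ᵐ ω ∂Pm, ∀ c : ℚ,
    Tendsto (fun N : ℕ => cnt (fun n => Int.fract (ω n)) c N / N) atTop (nhds (clamp c)) := by
  rw [ae_all_iff]
  intro c
  set S : Set ℝ := {u : ℝ | Int.fract u < c} with hS
  have hm : MeasurableSet S :=
    measurableSet_lt measurable_fract measurable_const
  let g : ℝ → ℝ := S.indicator 1
  have hg : Measurable g := measurable_one.indicator hm
  have hind := ProbabilityTheory.iIndepFun_infinitePi (P := fun _ : ℕ => nu)
    (X := fun _ => g) (fun _ => hg)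
  have hmp : ∀ i, MeasurePreserving (Function.eval i) Pm nu := fun i =>
    measurePreserving_eval_infinitePi (fun _ : ℕ => nu) i
  have hgi : Integrable g nu := (integrable_const (1:ℝ)).indicator hm
  have key := ProbabilityTheory.strong_law_ae_real (μ := Pm)
    (fun i (ω : ℕ → ℝ) => g (ω i))
    ((hmp 0).integrable_comp_of_integrable hgi)
    (fun i j hij => hind.indepFun hij)
    (fun i => ⟨(hg.comp (measurable_pi_apply i)).aemeasurable,
      (hg.comp (measurable_pi_apply 0)).aemeasurable, by
        have e : ∀ k, Measure.map (fun ω : ℕ → ℝ => g (ω k)) Pm = Measure.map g nu := by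
          intro k
          rw [← (hmp k).map_eq, Measure.map_map hg (hmp k).measurable]
          rfl
        rw [e, e]⟩)
  have hint : ∫ ω, g (ω 0) ∂Pm = clamp c := by
    have : ∫ ω, g (ω 0) ∂Pm = ∫ u, g u ∂nu := by
      rw [← (hmp 0).map_eq, integral_map (hmp 0).measurable.aemeasurable hg.aestronglyMeasurable]
    rw [this, integral_indicator_one hm, hS, nu_lt]
  rw [hint] at key
  filter_upwards [key] with ω hω
  refine hω.congr fun N => ?_
  congr 1

lemma measurable_dig (m : ℕ) : Measurable (dig m) := by
  unfold dig
  exact (Nat.measurable_floor.comp (measurable_fract.mul_const _)).const_add 1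

lemma nu_dig {m : ℕ} (hm : 2 ≤ m) (e : ℕ) :
    nu {u | dig m u = e} ≤ ENNReal.ofReal (1 / ((m:ℝ) - 1)) := by
  have hm' : (2:ℝ) ≤ m := by exact_mod_cast hm
  have hms : MeasurableSet {u | dig m u = e} := measurable_dig m (measurableSet_singleton e)
  rw [nu, Measure.restrict_apply hms]
  have hp : (0:ℝ) < m - 1 := by linarith
  calc _ ≤ volume (Set.Icc (((e:ℝ)-1)/((m:ℝ)-1)) ((e:ℝ)/((m:ℝ)-1))) := by
        apply measure_mono
        rintro u ⟨h1, h2⟩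
        have h1 : dig m u = e := h1
        have h := dig_bounds hm u
        rw [h1, Int.fract_eq_self.2 h2] at h
        constructor
        · rw [div_le_iff₀ hp]; linarith [h.2]
        · rw [le_div_iff₀ hp]; linarith [h.1]
    _ = _ := by
        rw [Real.volume_Icc]
        congr 1
        field_simp
        ring

def EE (q : ℕ → ℕ) (ω : ℕ → ℝ) : ℕ → ℕ := fun k => dig (q k) (ω k)

lemma Pm_pre {q : ℕ → ℕ} (hq : ∀ n, 2 ≤ q n) (n : ℕ) (m : ℤ) :
    Pm {ω | (pre q (EE q ω) n : ℤ) = m} ≤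
      ∏ i ∈ Finset.range n, ENNReal.ofReal (1 / ((q i:ℝ) - 1)) := by
  by_cases hne : ∃ ω0 : ℕ → ℝ, (pre q (EE q ω0) n : ℤ) = m
  · obtain ⟨ω0, h0⟩ := hne
    calc _ ≤ Pm (Set.pi (Finset.range n) (fun i => {u | dig (q i) u = dig (q i) (ω0 i)})) := by
          apply measure_mono
          intro ω hω
          have hω : (pre q (EE q ω) n : ℤ) = m := hω
          have e : pre q (EE q ω) n = pre q (EE q ω0) n := by
            have := hω.trans h0.symm
            exact_mod_cast this
          intro i hi
          exact pre_inj (fun k => dig_lt (hq k) _) (fun k => dig_lt (hq k) _) n e i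
            (by simpa using hi)
      _ = ∏ i ∈ Finset.range n, nu {u | dig (q i) u = dig (q i) (ω0 i)} := by
          unfold Pm
          rw [Measure.infinitePi_pi]
          intro i _
          exact measurable_dig _ (measurableSet_singleton _)
      _ ≤ _ := Finset.prod_le_prod' fun i _ => nu_dig (hq i) _
  · have : {ω | (pre q (EE q ω) n : ℤ) = m} = ∅ := by
      ext ω
      simp only [Set.mem_ofPred_eq, Set.mem_empty_iff_false, iff_false]
      exact fun h => hne ⟨ω, h⟩
    rw [this]
    simp

def xx (q : ℕ → ℕ) (ω : ℕ → ℝ) : ℝ := ∑' k, (EE q ω k : ℝ) / cantorProd q (k+1)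

lemma EE_lt {q : ℕ → ℕ} (hq : ∀ n, 2 ≤ q n) (ω : ℕ → ℝ) : ∀ n, EE q ω n < q n :=
  fun k => dig_lt (hq k) _

lemma measurable_xx {q : ℕ → ℕ} (hq : ∀ n, 2 ≤ q n) : Measurable (xx q) := by
  refine measurable_of_tendsto_metrizable
    (f := fun n ω => ∑ k ∈ Finset.range n, (EE q ω k : ℝ) / cantorProd q (k+1)) ?_ ?_
  · intro n
    refine Finset.measurable_fun_sum _ fun k _ => ?_
    refine Measurable.div_const ?_ _
    exact (measurable_from_top (f := fun n : ℕ => (n:ℝ))).comp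
      ((measurable_dig (q k)).comp (measurable_pi_apply k))
  · rw [tendsto_pi_nhds]
    intro ω
    have := summable_tail hq (EE_lt hq ω) 0
    simp only [zero_add] at this
    exact this.hasSum.tendsto_sum_nat

/-- Ratio product. -/
def RR (q : ℕ → ℕ) (n : ℕ) : ℝ := ∏ i ∈ Finset.range n, ((q i : ℝ) / ((q i : ℝ) - 1))

lemma Pm_ball {q : ℕ → ℕ} (hq : ∀ n, 2 ≤ q n) (n : ℕ) (y r : ℝ)
    (hr : 1 ≤ r * cantorProd q n) :
    Pm {ω | xx q ω ∈ Set.Icc (y - r) (y + r)} ≤ ENNReal.ofReal (4 * r * RR q n) := by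
  have hP := cP_pos hq n
  set P := cantorProd q n with hPdef
  set A := P * (y - r) - 1 with hA
  set B := P * (y + r) with hB
  have hsub : {ω | xx q ω ∈ Set.Icc (y - r) (y + r)} ⊆
      ⋃ m ∈ Finset.Icc ⌈A⌉ ⌊B⌋, {ω | (pre q (EE q ω) n : ℤ) = m} := by
    intro ω hω
    have hω : xx q ω ∈ Set.Icc (y - r) (y + r) := hω
    have h := tailT_pre hq (EE_lt hq ω) n
    have h0 := tailT_nonneg (E := EE q ω) hq n
    have h1 := tailT_le_one hq (EE_lt hq ω) n
    change P * xx q ω = _ at h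
    have a1 := mul_le_mul_of_nonneg_left hω.1 hP.le
    have a2 := mul_le_mul_of_nonneg_left hω.2 hP.le
    simp only [Set.mem_iUnion]
    refine ⟨(pre q (EE q ω) n : ℤ), ?_, rfl⟩
    rw [Finset.mem_Icc, Int.ceil_le, Int.le_floor]
    push_cast
    constructor <;> linarith
  have hcard : ((Finset.Icc ⌈A⌉ ⌊B⌋).card : ℝ) ≤ 4 * r * P := by
    rw [Int.card_Icc]
    have h1 := Int.floor_le B
    have h2 := Int.le_ceil A
    have h3 : B - A + 1 ≤ 4 * r * P := by rw [hA, hB]; nlinarith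
    have h4 : ((⌊B⌋ + 1 - ⌈A⌉ : ℤ) : ℝ) ≤ 4 * r * P := by push_cast; linarith
    have h5 : (((⌊B⌋ + 1 - ⌈A⌉).toNat : ℤ) : ℝ) ≤ 4 * r * P := by
      rw [Int.toNat_eq_max, Int.cast_max]
      apply max_le h4
      push_cast; nlinarith
    exact_mod_cast h5
  have hprod : ∏ i ∈ Finset.range n, ENNReal.ofReal (1 / ((q i:ℝ) - 1)) =
      ENNReal.ofReal (∏ i ∈ Finset.range n, (1 / ((q i:ℝ) - 1))) := by
    rw [ENNReal.ofReal_prod_of_nonneg]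
    intro i _
    have : (2:ℝ) ≤ q i := by exact_mod_cast hq i
    apply div_nonneg zero_le_one; linarith
  calc _ ≤ Pm (⋃ m ∈ Finset.Icc ⌈A⌉ ⌊B⌋, {ω | (pre q (EE q ω) n : ℤ) = m}) := measure_mono hsub
    _ ≤ ∑ m ∈ Finset.Icc ⌈A⌉ ⌊B⌋, Pm {ω | (pre q (EE q ω) n : ℤ) = m} :=
        measure_biUnion_finset_le _ _
    _ ≤ ∑ m ∈ Finset.Icc ⌈A⌉ ⌊B⌋, ENNReal.ofReal (∏ i ∈ Finset.range n, (1 / ((q i:ℝ) - 1))) := by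
        apply Finset.sum_le_sum
        intro m _
        rw [← hprod]
        exact Pm_pre hq n m
    _ = ENNReal.ofReal ((Finset.Icc ⌈A⌉ ⌊B⌋).card * ∏ i ∈ Finset.range n, (1 / ((q i:ℝ) - 1))) := by
        rw [Finset.sum_const, nsmul_eq_mul, ENNReal.ofReal_mul (by positivity),
          ENNReal.ofReal_natCast]
    _ ≤ _ := by
        apply ENNReal.ofReal_le_ofReal
        have hR : RR q n = P * ∏ i ∈ Finset.range n, (1 / ((q i:ℝ) - 1)) := by
          rw [hPdef]
          unfold RR cantorProd
          rw [← Finset.prod_mul_distrib]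
          apply Finset.prod_congr rfl
          intro i _
          ring
        rw [hR, ← mul_assoc]
        apply mul_le_mul_of_nonneg_right hcard
        apply Finset.prod_nonneg
        intro i _
        have : (2:ℝ) ≤ q i := by exact_mod_cast hq i
        apply div_nonneg zero_le_one; linarith

lemma RR_bound {q : ℕ → ℕ} (hq : ∀ n, 2 ≤ q n) (hlim : Tendsto q atTop atTop) {ε : ℝ}
    (hε : 0 < ε) : ∃ C : ℝ, 0 < C ∧ ∀ n, RR q n ≤ C * cantorProd q n ^ ε := by
  have h1 : Tendsto (fun n => (q n : ℝ) ^ ε) atTop atTop :=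
    (tendsto_rpow_atTop hε).comp (tendsto_natCast_atTop_atTop.comp hlim)
  obtain ⟨N, hN⟩ := eventually_atTop.1 (h1.eventually_ge_atTop 2)
  refine ⟨2^N, by positivity, fun n => ?_⟩
  have hfac : ∀ i, 0 ≤ (q i : ℝ) / ((q i : ℝ) - 1) ∧ (q i : ℝ) / ((q i : ℝ) - 1) ≤ 2 := by
    intro i
    have : (2:ℝ) ≤ q i := by exact_mod_cast hq i
    refine ⟨div_nonneg (by linarith) (by linarith), ?_⟩
    rw [div_le_iff₀ (by linarith)]; linarith
  have hone : ∀ i, 1 ≤ (q i : ℝ) ^ ε := by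
    intro i
    have : (2:ℝ) ≤ q i := by exact_mod_cast hq i
    exact Real.one_le_rpow (by linarith) hε.le
  have key : ∀ n, RR q n ≤ 2 ^ (min n N) * cantorProd q n ^ ε := by
    intro n
    induction n with
    | zero => simp [RR, cP_zero]
    | succ n ih =>
      have hP := cP_pos hq n
      have e1 : RR q (n+1) = RR q n * ((q n : ℝ) / ((q n : ℝ) - 1)) := by
        rw [RR, RR, Finset.prod_range_succ]
      rw [e1, cP_succ, Real.mul_rpow hP.le (by positivity)]
      have hPe : 0 < cantorProd q n ^ ε := Real.rpow_pos_of_pos hP ε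
      by_cases h : n < N
      · rw [min_eq_left (by omega : n + 1 ≤ N)]
        rw [min_eq_left (by omega : n ≤ N)] at ih
        calc _ ≤ (2^n * cantorProd q n ^ ε) * 2 := by
              apply mul_le_mul ih (hfac n).2 (hfac n).1 (by positivity)
          _ = 2^(n+1) * (cantorProd q n ^ ε * 1) := by ring
          _ ≤ _ := by gcongr; exact hone n
      · rw [min_eq_right (by omega : N ≤ n + 1)]
        rw [min_eq_right (by omega : N ≤ n)] at ih
        calc _ ≤ (2^N * cantorProd q n ^ ε) * 2 := by
              apply mul_le_mul ih (hfac n).2 (hfac n).1 (by positivity)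
          _ ≤ (2^N * cantorProd q n ^ ε) * (q n : ℝ)^ε := by
              gcongr; exact hN n (by omega)
          _ = _ := by ring
  refine (key n).trans ?_
  have := Real.rpow_nonneg (cP_pos hq n).le ε
  gcongr
  · norm_num
  · exact min_le_right _ _

lemma Pm_holder {q : ℕ → ℕ} (hq : ∀ n, 2 ≤ q n) (hlim : Tendsto q atTop atTop) {ε : ℝ}
    (hε : 0 < ε) : ∃ C : ℝ, 0 < C ∧ ∀ y r : ℝ, 0 < r → r < 1 →
      Pm {ω | xx q ω ∈ Set.Icc (y - r) (y + r)} ≤ ENNReal.ofReal (C * r ^ (1 - ε)) := by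
  obtain ⟨C, hC, hR⟩ := RR_bound hq hlim hε
  refine ⟨8 * C, by positivity, fun y r hr hr1 => ?_⟩
  have hex : ∃ n, 1 ≤ r * cantorProd q n := by
    obtain ⟨n, hn⟩ := pow_unbounded_of_one_lt (1/r) (one_lt_two (α := ℝ))
    refine ⟨n, ?_⟩
    have := cP_two_pow hq n
    rw [div_lt_iff₀ hr] at hn
    nlinarith
  have hspec := Nat.find_spec hex
  have hmin := fun m => Nat.find_min hex (m := m)
  revert hspec hmin
  generalize Nat.find hex = n
  intro hspec hmin
  rcases n with _ | n
  · rw [cP_zero] at hspec; linarith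
  · have hlt := not_le.1 (hmin n (Nat.lt_succ_self n))
    refine (Pm_ball hq (n+1) y r hspec).trans (ENNReal.ofReal_le_ofReal ?_)
    have hP := cP_pos hq n
    have hq2 : (2:ℝ) ≤ q n := by exact_mod_cast hq n
    have e1 : RR q (n+1) = RR q n * ((q n : ℝ) / ((q n : ℝ) - 1)) := by
      rw [RR, RR, Finset.prod_range_succ]
    have f2 : (q n : ℝ) / ((q n : ℝ) - 1) ≤ 2 := by
      rw [div_le_iff₀ (by linarith)]; linarith
    have hR0 : 0 ≤ RR q n := by
      apply Finset.prod_nonneg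
      intro i _
      have : (2:ℝ) ≤ q i := by exact_mod_cast hq i
      exact div_nonneg (by linarith) (by linarith)
    have hPr : cantorProd q n ^ ε ≤ (r⁻¹) ^ ε := by
      apply Real.rpow_le_rpow hP.le _ hε.le
      rw [← one_div, le_div_iff₀ hr]; linarith
    have e2 : r ^ (1 - ε) = r * (r⁻¹)^ε := by
      rw [Real.rpow_sub hr, Real.rpow_one, Real.inv_rpow hr.le]; rfl
    rw [e1, e2]
    calc 4 * r * (RR q n * ((q n : ℝ) / ((q n : ℝ) - 1))) ≤ 4 * r * (RR q n * 2) := by gcongr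
      _ ≤ 4 * r * ((C * cantorProd q n ^ ε) * 2) := by gcongr; exact hR n
      _ ≤ 4 * r * ((C * (r⁻¹) ^ ε) * 2) := by gcongr
      _ = _ := by ring

lemma dim_lower {q : ℕ → ℕ} (hq : ∀ n, 2 ≤ q n) (hlim : Tendsto q atTop atTop) (A : Set ℝ)
    (hA : ∀ᵐ ω ∂Pm, xx q ω ∈ A) (s : NNReal) (hs : s < 1) : (s : ENNReal) ≤ dimH A := by
  have hs' : (s : ℝ) < 1 := by exact_mod_cast hs
  rcases eq_or_ne s 0 with rfl | hs0
  · simp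
  have hs0' : (0:ℝ) < s := by exact_mod_cast pos_iff_ne_zero.2 hs0
  obtain ⟨C, hC, hH⟩ := Pm_holder hq hlim (ε := 1 - s) (by linarith)
  simp only [sub_sub_cancel] at hH
  set μ : Measure ℝ := Pm.map (xx q) with hμ
  have hmx := measurable_xx hq
  have hμI : ∀ y r : ℝ, 0 < r → r < 1 → μ (Set.Icc (y - r) (y + r)) ≤
      ENNReal.ofReal (C * r ^ (s:ℝ)) := by
    intro y r h0 h1
    rw [hμ, Measure.map_apply hmx measurableSet_Icc]
    exact hH y r h0 h1
  have hC0 : ENNReal.ofReal C ≠ 0 := by simpa using hC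
  have hle : (ENNReal.ofReal C)⁻¹ • μ ≤ μH[(s:ℝ)] := by
    apply Measure.le_hausdorffMeasure (s:ℝ) _ (ENNReal.ofReal (1/2)) (by simp)
    intro S hS
    rcases S.eq_empty_or_nonempty with rfl | ⟨y, hy⟩
    · simp
    have hfin : Metric.ediam S ≠ ⊤ := ne_top_of_le_ne_top ENNReal.ofReal_ne_top hS
    set d := (Metric.ediam S).toReal with hd
    have hdE : Metric.ediam S = ENNReal.ofReal d := (ENNReal.ofReal_toReal hfin).symm
    have hd0 : 0 ≤ d := ENNReal.toReal_nonneg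
    have hd1 : d ≤ 1/2 := by
      rw [hdE] at hS
      exact (ENNReal.ofReal_le_ofReal_iff (by norm_num)).1 hS
    have hsub : ∀ r, d ≤ r → S ⊆ Set.Icc (y - r) (y + r) := by
      intro r hr z hz
      have h1 : edist z y ≤ ENNReal.ofReal d := hdE ▸ Metric.edist_le_ediam_of_mem hz hy
      rw [edist_dist, ENNReal.ofReal_le_ofReal_iff hd0, Real.dist_eq, abs_le] at h1
      constructor <;> linarith [h1.1, h1.2]
    have hbound : ∀ᶠ r in nhdsWithin d (Set.Ioi d), μ S ≤ ENNReal.ofReal (C * r ^ (s:ℝ)) := by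
      filter_upwards [Ioo_mem_nhdsGT (show d < 1 by linarith)] with r hr
      exact (measure_mono (hsub r hr.1.le)).trans (hμI y r (by linarith [hr.1]) hr.2)
    have hcont : Tendsto (fun r : ℝ => ENNReal.ofReal (C * r ^ (s:ℝ))) (nhdsWithin d (Set.Ioi d))
        (nhds (ENNReal.ofReal (C * d ^ (s:ℝ)))) := by
      apply ENNReal.tendsto_ofReal
      apply Tendsto.mono_left _ nhdsWithin_le_nhds
      exact ((Real.continuousAt_rpow_const d s (Or.inr hs0'.le)).tendsto).const_mul C
    have hfinal : μ S ≤ ENNReal.ofReal (C * d ^ (s:ℝ)) := ge_of_tendsto hcont hbound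
    rw [Measure.smul_apply, smul_eq_mul, hdE, ENNReal.ofReal_rpow_of_nonneg hd0 hs0'.le]
    rw [ENNReal.ofReal_mul hC.le] at hfinal
    calc _ ≤ (ENNReal.ofReal C)⁻¹ * (ENNReal.ofReal C * ENNReal.ofReal (d ^ (s:ℝ))) := by gcongr
      _ = _ := by
        rw [← mul_assoc, ENNReal.inv_mul_cancel hC0 ENNReal.ofReal_ne_top, one_mul]
  apply le_dimH_of_hausdorffMeasure_ne_zero
  intro h0
  have h1 := hle A
  rw [h0] at h1
  have h2 : μ A = 0 := by
    have : (ENNReal.ofReal C)⁻¹ * μ A = 0 := by simpa using h1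
    rcases mul_eq_zero.1 this with h | h
    · simp at h
    · exact h
  have h3 := Measure.le_map_apply (μ := Pm) hmx.aemeasurable A
  have h4 : Pm (xx q ⁻¹' A) = 0 := le_antisymm (h3.trans h2.le) bot_le
  have h5 : ∀ᵐ ω ∂Pm, False := by
    filter_upwards [hA, measure_eq_zero_iff_ae_notMem.1 h4] with ω a b
    exact b a
  simp at h5
  exact IsProbabilityMeasure.ne_zero Pm h5

/-- If `q n → ∞`, then `DN(Q) \ ⋃ⱼ RNⱼ(Q)` has Hausdorff dimension 1. -/
theorem dimH_DN_diff_unionRN (q : ℕ → ℕ) (hq : ∀ n, 2 ≤ q n)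
    (hlim : Tendsto q atTop atTop) :
    dimH ({x : ℝ | QDistNormal q x} \
        ⋃ j ∈ Set.Ici 1, {x : ℝ | QRatioNormalOrder q j x}) = 1 := by
  apply le_antisymm
  · calc _ ≤ dimH (Set.univ : Set ℝ) := dimH_mono (Set.subset_univ _)
      _ = 1 := Real.dimH_univ
  · apply ENNReal.le_of_forall_nnreal_lt
    intro s hs
    apply dim_lower hq hlim _ _ s (by exact_mod_cast hs)
    filter_upwards [ae_ud] with ω hω
    exact good_mem hq hlim ω hω
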